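/- Let X ⊆ ℝ be a countable set and let f be an arbitrary real-valued function defined on finite multisets with elements from X. Then there exist functions φ : ℝ → ℝ with range contained in [0,1] and ρ : ℝ → ℝ such that f(m) = ρ(∑_{x∈m} φ(x)) for every finite multiset m all of whose elements lie in X, where the sum is over the multiset with multiplicity. -/

import Mathlib

/-- There is a real number in `[0, 1)` that is transcendental over `ℤ`. -/
theorem exists_transcendental_mem_Ico : ∃ t ∈ Set.Ico (0 : ℝ) 1, Transcendental ℤ t := by
  refine ⟨Int.fract (liouvilleNumber (2 : ℕ)), ⟨Int.fract_nonneg _, Int.fract_lt_one _⟩, ?_⟩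
  intro h
  refine transcendental_liouvilleNumber le_rfl ?_
  rw [← Int.floor_add_fract (liouvilleNumber (2 : ℕ))]
  exact (isAlgebraic_intCast _).add h

/-- The coefficients of a sum of monomials indexed by a multiset are its multiplicities. -/
theorem Multiset.coeff_sum_map_X_pow (m : Multiset ℕ) (n : ℕ) :
    ((m.map fun k => (Polynomial.X : Polynomial ℤ) ^ k).sum).coeff n = m.count n := by
  induction m using Multiset.induction_on with
  | empty => simp
  | cons a s ih =>
    simp only [Multiset.map_cons, Multiset.sum_cons, Polynomial.coeff_add, ih,
      Polynomial.coeff_X_pow, Multiset.count_cons]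
    split_ifs <;> simp [add_comm]

/-- A finite multiset of exponents is determined by its sum of powers of a transcendental. -/
theorem Transcendental.injective_sum_map_pow {t : ℝ} (ht : Transcendental ℤ t) :
    Function.Injective fun m : Multiset ℕ => (m.map fun k => t ^ k).sum := by
  have key (m : Multiset ℕ) : (m.map fun k => t ^ k).sum =
      Polynomial.aeval t (m.map fun k => (Polynomial.X : Polynomial ℤ) ^ k).sum := by
    simp [map_multiset_sum]
  intro m m' h
  simp only [key] at h
  have hpoly := transcendental_iff_injective.mp ht h
  ext n
  have hcoeff := congrArg (fun p => Polynomial.coeff p n) hpoly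
  simpa only [Multiset.coeff_sum_map_X_pow, Nat.cast_inj] using hcoeff

/-- Sum-decomposition form of Proposition 1: every real-valued function on finite multisets
over a countable `X ⊆ ℝ` factors as `ρ (∑_{x ∈ m} φ(x))` with `φ` taking values in `[0,1]`. -/
theorem sum_decomposition_universal (X : Set ℝ) (hX : X.Countable)
    (F : Multiset ℝ → ℝ) :
    ∃ (φ ρ : ℝ → ℝ), Set.range φ ⊆ Set.Icc (0 : ℝ) 1 ∧
      ∀ m : Multiset ℝ, (∀ x ∈ m, x ∈ X) → F m = ρ ((m.map φ).sum) := by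
  obtain ⟨t, ⟨ht0, ht1⟩, ht⟩ := exists_transcendental_mem_Ico
  let decode : ℕ → ℝ := Set.enumerateCountable hX 0
  let encode : ℝ → ℕ := Function.invFun decode
  let powerSum : Multiset ℕ → ℝ := fun m => (m.map fun k => t ^ k).sum
  refine ⟨fun x => t ^ encode x, fun s => F ((Function.invFun powerSum s).map decode), ?_, ?_⟩
  · rintro _ ⟨x, rfl⟩
    exact ⟨pow_nonneg ht0 _, pow_le_one₀ ht0 ht1.le⟩
  · intro m hm
    have hsum : (m.map fun x => t ^ encode x).sum = powerSum (m.map encode) := by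
      simp [powerSum, Multiset.map_map]
    have hdecode : (m.map encode).map decode = m := by
      rw [Multiset.map_map]
      refine (Multiset.map_congr rfl fun x hx => ?_).trans (Multiset.map_id m)
      exact Function.invFun_eq (Set.subset_range_enumerate hX 0 (hm x hx))
    simp only [hsum]
    rw [Function.leftInverse_invFun ht.injective_sum_map_pow, hdecode]
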